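/- There is a constant C > 0 such that for all sufficiently large r, the number of subsets A ⊆ {0,1,…,r−1} with |A+A| > |A−A| is at least C·2^r/r⁴; that is, the proportion of subsets of {0,…,r−1} that are MSTD is at least C/r⁴. -/

import Mathlib

open Finset Filter
open scoped Pointwise

/-- The number of MSTD (sum-dominant) subsets of `{0, 1, …, r-1}`. -/
noncomputable def mstdCount (r : ℕ) : ℕ :=
  ((Finset.Icc (0 : ℤ) ((r : ℤ) - 1)).powerset.filter
    fun A => (A - A).card < (A + A).card).card

/-- A fringe structure together with a hitting condition forces sum-dominance. -/
lemma mstd_of_fringe (n t : ℤ) (ht : 8 ≤ t) (hn : 22 + 3 * t ≤ n) (A : Finset ℤ)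
    (hA : ∀ a ∈ A, 0 ≤ a ∧ a ≤ n - 1)
    (h0 : (0 : ℤ) ∈ A) (h2 : (2 : ℤ) ∈ A) (h3 : (3 : ℤ) ∈ A)
    (hlow : ∀ a, 7 ≤ a → a ≤ 10 + t → a ∈ A)
    (hhigh : ∀ a, n - 11 - t ≤ a → a ≤ n - 8 → a ∈ A)
    (k1 : n - 1 ∈ A) (k2 : n - 2 ∈ A) (k3 : n - 3 ∈ A) (k6 : n - 6 ∈ A)
    (n1 : (1 : ℤ) ∉ A) (n4 : (4 : ℤ) ∉ A) (n5 : (5 : ℤ) ∉ A) (n6 : (6 : ℤ) ∉ A)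
    (m7 : n - 7 ∉ A) (m5 : n - 5 ∉ A) (m4 : n - 4 ∉ A)
    (hit : ∀ x, 11 + t ≤ x → x + t - 1 ≤ n - 12 - t → ∃ a ∈ A, x ≤ a ∧ a ≤ x + t - 1) :
    (A - A).card < (A + A).card := by
  have hit' : ∀ x, 7 ≤ x → x ≤ n - 8 → ∃ a ∈ A, x ≤ a ∧ a ≤ x + t - 1 := by
    intro x hx1 hx2
    by_cases c1 : x ≤ 10 + t
    · exact ⟨x, hlow x hx1 c1, le_rfl, by omega⟩
    by_cases c2 : x + t - 1 ≤ n - 12 - t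
    · exact hit x (by omega) c2
    by_cases c3 : n - 11 - t ≤ x
    · exact ⟨x, hhigh x c3 hx2, le_rfl, by omega⟩
    · exact ⟨n - 11 - t, hhigh _ le_rfl (by omega), by omega, by omega⟩
  have key : ∀ k, 0 ≤ k → k ≤ 2 * n - 2 → k ≠ 1 → ∃ a ∈ A, ∃ b ∈ A, a + b = k := by
    intro k hk0 hk1 hk
    by_cases c1 : k ≤ 20 + 2 * t
    · by_cases d : k ≤ 6
      · have : k = 0 ∨ k = 2 ∨ k = 3 ∨ k = 4 ∨ k = 5 ∨ k = 6 := by omega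
        rcases this with h | h | h | h | h | h
        · exact ⟨0, h0, 0, h0, by omega⟩
        · exact ⟨0, h0, 2, h2, by omega⟩
        · exact ⟨0, h0, 3, h3, by omega⟩
        · exact ⟨2, h2, 2, h2, by omega⟩
        · exact ⟨2, h2, 3, h3, by omega⟩
        · exact ⟨3, h3, 3, h3, by omega⟩
      by_cases d2 : k ≤ 10 + t
      · exact ⟨0, h0, k, hlow k (by omega) d2, by omega⟩
      by_cases d3 : k ≤ 17 + t
      · exact ⟨7, hlow 7 le_rfl (by omega), k - 7, hlow _ (by omega) (by omega), by omega⟩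
      · exact ⟨10 + t, hlow _ (by omega) (by omega), k - (10 + t),
          hlow _ (by omega) (by omega), by omega⟩
    by_cases c2 : 2 * n - k ≤ 22 + 2 * t
    · by_cases d : 2 * n - k ≤ 8
      · have : 2 * n - k = 2 ∨ 2 * n - k = 3 ∨ 2 * n - k = 4 ∨ 2 * n - k = 5 ∨ 2 * n - k = 6
            ∨ 2 * n - k = 7 ∨ 2 * n - k = 8 := by omega
        rcases this with h | h | h | h | h | h | h
        · exact ⟨_, k1, _, k1, by omega⟩
        · exact ⟨_, k1, _, k2, by omega⟩
        · exact ⟨_, k1, _, k3, by omega⟩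
        · exact ⟨_, k2, _, k3, by omega⟩
        · exact ⟨_, k3, _, k3, by omega⟩
        · exact ⟨_, k1, _, k6, by omega⟩
        · exact ⟨_, k2, _, k6, by omega⟩
      by_cases d2 : 2 * n - k ≤ 12 + t
      · exact ⟨n - 1, k1, k - (n - 1), hhigh _ (by omega) (by omega), by omega⟩
      by_cases d3 : 2 * n - k ≤ 19 + t
      · exact ⟨n - 8, hhigh _ (by omega) (by omega), k - (n - 8),
          hhigh _ (by omega) (by omega), by omega⟩
      · exact ⟨n - 11 - t, hhigh _ (by omega) (by omega), k - (n - 11 - t),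
          hhigh _ (by omega) (by omega), by omega⟩
    by_cases c3 : k ≤ n - 1
    · obtain ⟨a, ha, h1, h2⟩ := hit' (k - 10 - t) (by omega) (by omega)
      exact ⟨a, ha, k - a, hlow _ (by omega) (by omega), by omega⟩
    · obtain ⟨a, ha, h1, h2⟩ := hit' (k - n + 8) (by omega) (by omega)
      exact ⟨a, ha, k - a, hhigh _ (by omega) (by omega), by omega⟩
  have hsum : (Finset.Icc (0 : ℤ) (2 * n - 2)).erase 1 ⊆ A + A := by
    intro k hk
    rw [Finset.mem_erase, Finset.mem_Icc] at hk
    obtain ⟨a, ha, b, hb, h⟩ := key k hk.2.1 hk.2.2 hk.1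
    exact Finset.mem_add.2 ⟨a, ha, b, hb, h⟩
  have nodiff : ∀ a ∈ A, ∀ b ∈ A, a - b ≠ n - 7 := by
    intro a ha b hb h
    have := hA a ha
    have := hA b hb
    have hb' : b = 0 ∨ b = 1 ∨ b = 2 ∨ b = 3 ∨ b = 4 ∨ b = 5 ∨ b = 6 := by omega
    rcases hb' with h | h | h | h | h | h | h
    · exact m7 ((by omega : a = n - 7) ▸ ha)
    · exact n1 (h ▸ hb)
    · exact m5 ((by omega : a = n - 5) ▸ ha)
    · exact m4 ((by omega : a = n - 4) ▸ ha)
    · exact n4 (h ▸ hb)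
    · exact n5 (h ▸ hb)
    · exact n6 (h ▸ hb)
  have hdiff : A - A ⊆ ((Finset.Icc (-(n - 1)) (n - 1)).erase (n - 7)).erase (-(n - 7)) := by
    intro d hd
    obtain ⟨a, ha, b, hb, rfl⟩ := Finset.mem_sub.1 hd
    have := hA a ha
    have := hA b hb
    have := nodiff a ha b hb
    have := nodiff b hb a ha
    simp only [Finset.mem_erase, Finset.mem_Icc]
    refine ⟨?_, ?_, ?_, ?_⟩ <;> omega
  have e1 := Finset.card_le_card hsum
  have e2 := Finset.card_le_card hdiff
  rw [Finset.card_erase_of_mem (by rw [Finset.mem_Icc]; omega), Int.card_Icc] at e1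
  rw [Finset.card_erase_of_mem (by rw [Finset.mem_erase, Finset.mem_Icc]; omega),
    Finset.card_erase_of_mem (by rw [Finset.mem_Icc]; omega), Int.card_Icc] at e2
  omega

/-- The forced elements. -/
noncomputable def fringe (n t : ℤ) : Finset ℤ :=
  {0, 2, 3, n - 1, n - 2, n - 3, n - 6} ∪ Finset.Icc 7 (10 + t) ∪ Finset.Icc (n - 11 - t) (n - 8)

lemma mem_fringe (n t a : ℤ) : a ∈ fringe n t ↔ (a = 0 ∨ a = 2 ∨ a = 3 ∨ a = n - 1 ∨ a = n - 2 ∨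
    a = n - 3 ∨ a = n - 6) ∨ (7 ≤ a ∧ a ≤ 10 + t) ∨ (n - 11 - t ≤ a ∧ a ≤ n - 8) := by
  simp only [fringe, Finset.mem_union, Finset.mem_insert, Finset.mem_singleton, Finset.mem_Icc]
  tauto

/-- The middle. -/
noncomputable def middle (n t : ℤ) : Finset ℤ := Finset.Icc (11 + t) (n - 12 - t)

/-- Middle sets hitting each window of length `t`. -/
noncomputable def goodMid (n t : ℤ) : Finset (Finset ℤ) :=
  (middle n t).powerset \
    (Finset.Icc (11 + t) (n - 11 - 2 * t)).biUnion
      fun x => (middle n t \ Finset.Icc x (x + t - 1)).powerset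

lemma goodMid_card (n t : ℕ) (hn : 22 + 3 * t ≤ n) (h : 2 * n ≤ 2 ^ t) :
    2 ^ (n - 22 - 2 * t) ≤ 2 * (goodMid n t).card := by
  have hm : (middle n t).card = n - 22 - 2 * t := by
    rw [middle, Int.card_Icc]; omega
  have hb : ((Finset.Icc (11 + (t : ℤ)) (n - 11 - 2 * t)).biUnion
      fun x => (middle n t \ Finset.Icc x (x + t - 1)).powerset).card
      ≤ n * 2 ^ (n - 22 - 2 * t - t) := by
    refine (Finset.card_biUnion_le_card_mul _ _ (2 ^ (n - 22 - 2 * t - t)) ?_).trans ?_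
    · intro x hx
      rw [Finset.mem_Icc] at hx
      rw [Finset.card_powerset, Finset.card_sdiff_of_subset, hm, Int.card_Icc]
      · apply Nat.pow_le_pow_right (by norm_num)
        omega
      · intro y hy
        rw [Finset.mem_Icc] at hy
        rw [middle, Finset.mem_Icc]
        omega
    · apply Nat.mul_le_mul_right
      rw [Int.card_Icc]
      omega
  have hg := Finset.le_card_sdiff ((Finset.Icc (11 + (t : ℤ)) (n - 11 - 2 * t)).biUnion
      fun x => (middle n t \ Finset.Icc x (x + t - 1)).powerset) (middle n t).powerset
  rw [Finset.card_powerset, hm] at hg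
  change _ ≤ (goodMid n t).card at hg
  have hp : 2 ^ (n - 22 - 2 * t) = 2 ^ t * 2 ^ (n - 22 - 2 * t - t) := by
    rw [← pow_add]; congr 1; omega
  have := Nat.mul_le_mul_right (2 ^ (n - 22 - 2 * t - t)) h
  rw [← hp, mul_assoc] at this
  omega

lemma goodMid_le (n t : ℕ) (ht : 8 ≤ t) (hn : 22 + 3 * t ≤ n) :
    (goodMid n t).card ≤ mstdCount n := by
  unfold mstdCount
  have hsub : ∀ M ∈ goodMid n t, ∀ a ∈ M, 11 + (t : ℤ) ≤ a ∧ a ≤ n - 12 - t := by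
    intro M hM a ha
    have := Finset.mem_powerset.1 (Finset.mem_sdiff.1 hM).1 ha
    rwa [middle, Finset.mem_Icc] at this
  apply Finset.card_le_card_of_injOn (fun M => fringe n t ∪ M)
  · intro M hM
    have hM : M ∈ goodMid n t := hM
    have hs := hsub M hM
    have hA : ∀ a, a ∈ fringe n t ∪ M → 0 ≤ a ∧ a ≤ (n : ℤ) - 1 := by
      intro a ha
      rw [Finset.mem_union, mem_fringe] at ha
      rcases ha with ha | ha
      · omega
      · have := hs a ha
        omega
    have hno : ∀ a, (a < 11 + (t : ℤ) ∨ (n : ℤ) - 12 - t < a) →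
        a ∉ fringe n t → a ∉ fringe n t ∪ M := by
      intro a h1 h2 h3
      rcases Finset.mem_union.1 h3 with h | h
      · exact h2 h
      · have := hs a h
        omega
    have hyes : ∀ a, a ∈ fringe n t → a ∈ fringe n t ∪ M :=
      fun a h => Finset.mem_union_left _ h
    simp only [Finset.coe_filter, Set.mem_ofPred_eq, Finset.mem_powerset]
    refine ⟨fun a ha => Finset.mem_Icc.2 (hA a ha), ?_⟩
    apply mstd_of_fringe n t (by omega) (by omega) _ hA
    case hit =>
      intro x h1 h2
      by_contra hcon
      push Not at hcon
      apply (Finset.mem_sdiff.1 hM).2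
      rw [Finset.mem_biUnion]
      refine ⟨x, Finset.mem_Icc.2 ⟨h1, by omega⟩, ?_⟩
      rw [Finset.mem_powerset]
      intro a ha
      rw [Finset.mem_sdiff, middle, Finset.mem_Icc, Finset.mem_Icc]
      refine ⟨hs a ha, ?_⟩
      rintro ⟨u, v⟩
      have := hcon a (Finset.mem_union_right _ ha) u
      omega
    case hlow => intro a _ _; apply hyes; rw [mem_fringe]; omega
    case hhigh => intro a _ _; apply hyes; rw [mem_fringe]; omega
    all_goals first
      | (apply hyes; rw [mem_fringe]; omega)
      | (apply hno
         · omega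
         · rw [mem_fringe]; omega)
  · intro M hM M' hM' h
    have hM : M ∈ goodMid n t := hM
    have hM' : M' ∈ goodMid n t := hM'
    have hs := hsub M hM
    have hs' := hsub M' hM'
    have h : fringe n t ∪ M = fringe n t ∪ M' := h
    have aux : ∀ a, 11 + (t : ℤ) ≤ a → a ≤ n - 12 - t → a ∉ fringe n t := by
      intro a _ _
      rw [mem_fringe]
      omega
    ext a
    have ha := Finset.ext_iff.1 h a
    rw [Finset.mem_union, Finset.mem_union] at ha
    constructor
    · intro q
      exact (ha.1 (Or.inr q)).resolve_left (aux a (hs a q).1 (hs a q).2)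
    · intro q
      exact (ha.2 (Or.inr q)).resolve_left (aux a (hs' a q).1 (hs' a q).2)

lemma aux_pow (s : ℕ) (hs : 8 ≤ s) : 6 * s + 50 ≤ 2 ^ s := by
  induction s, hs using Nat.le_induction with
  | base => norm_num
  | succ k hk ih => rw [pow_succ]; omega

/-- There is a constant `C > 0` such that for all sufficiently large `r`, the number of
MSTD subsets of `{0,…,r-1}` is at least `C·2^r/r⁴`. -/
theorem mstd_density_lower_bound :
    ∃ C : ℝ, 0 < C ∧ ∃ N : ℕ, ∀ r : ℕ, N ≤ r →
      C * 2 ^ r / (r : ℝ) ^ 4 ≤ (mstdCount r : ℝ) := by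
  refine ⟨1 / 2 ^ 27, by positivity, 200, fun r hr => ?_⟩
  set t := Nat.clog 2 (2 * r) with ht
  have h1 : 2 * r ≤ 2 ^ t := Nat.le_pow_clog (by norm_num) _
  have h2 : 2 ^ t ≤ 4 * r := by
    have := Nat.pow_pred_clog_lt_self (b := 2) (by norm_num) (x := 2 * r) (by omega)
    have ht0 : t ≠ 0 := by
      intro h0
      rw [h0] at h1
      omega
    obtain ⟨s, hs⟩ := Nat.exists_eq_succ_of_ne_zero ht0
    rw [← ht, hs, Nat.pred_succ] at this
    rw [hs, pow_succ]
    omega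
  have h3 : 8 ≤ t := by
    by_contra hc
    have : 2 ^ t ≤ 2 ^ 7 := Nat.pow_le_pow_right (by norm_num) (by omega)
    omega
  have h4 : t ≤ (r - 22) / 3 := by
    rw [ht]
    apply (Nat.clog_le_iff_le_pow (by norm_num)).2
    have := aux_pow ((r - 22) / 3) (by omega)
    omega
  have h5 : 22 + 3 * t ≤ r := by omega
  have g1 := goodMid_card r t h5 h1
  have g2 := goodMid_le r t h3 h5
  have g3 : 2 ^ (r - 22 - 2 * t) ≤ 2 * mstdCount r := by omega
  have g4 : (2 : ℕ) ^ r = 2 ^ 22 * (2 ^ t) ^ 2 * 2 ^ (r - 22 - 2 * t) := by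
    rw [← pow_mul, ← pow_add, ← pow_add]; congr 1; omega
  have g5 : 2 ^ r ≤ 2 ^ 22 * (4 * r) ^ 2 * (2 * mstdCount r) := by
    rw [g4]; gcongr
  have g6 : (2 : ℝ) ^ r ≤ 2 ^ 22 * (4 * r) ^ 2 * (2 * mstdCount r) := by exact_mod_cast g5
  have hr1 : (1 : ℝ) ≤ r := by exact_mod_cast (by omega : 1 ≤ r)
  have hr4 : (r : ℝ) ^ 2 ≤ (r : ℝ) ^ 4 := pow_le_pow_right₀ hr1 (by norm_num)
  rw [div_le_iff₀ (by positivity)]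
  have g7 : (mstdCount r : ℝ) * r ^ 2 ≤ mstdCount r * r ^ 4 := by gcongr
  linarith
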